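/- Let m ≥ 1 and let α be a real algebraic number of degree exactly m with q = H(α). Then β = α / (2(1 + α²)) is a real algebraic number with H(β) ≤ 2^{6m} · q³. -/

import Mathlib

open Polynomial

/-- The primitive minimal polynomial over ℤ of a real number. -/
noncomputable def intMinpoly (α : ℝ) : Polynomial ℤ :=
  (IsLocalization.integerNormalization (nonZeroDivisors ℤ) (minpoly ℚ α)).primPart

/-- The height of an algebraic number: the maximum of the absolute values of the
coefficients of its primitive minimal polynomial over ℤ. -/
noncomputable def algHeight (α : ℝ) : ℕ :=
  (intMinpoly α).support.sup fun i => ((intMinpoly α).coeff i).natAbs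

/-- `α` is a real algebraic number of degree exactly `m`. -/
def DegreeExactly (m : ℕ) (α : ℝ) : Prop :=
  IsAlgebraic ℚ α ∧ (minpoly ℚ α).natDegree = m

/-- `exp^[3](x) = e^(e^(e^x))`. -/
noncomputable def expCube (x : ℝ) : ℝ := Real.exp (Real.exp (Real.exp x))

/-- `ξ` is an `m`-ultra number: there is a sequence `(α_n)_{n ≥ 1}` of pairwise distinct
real algebraic numbers of degree exactly `m` with
`0 < |ξ - α_n| < (exp^[3](H(α_n)))^{-n}` for all `n ≥ 1`. Here `a k` plays the
role of `α_{k+1}`. -/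
def IsMUltra (m : ℕ) (ξ : ℝ) : Prop :=
  ∃ a : ℕ → ℝ, Function.Injective a ∧
    ∀ n : ℕ, DegreeExactly m (a n) ∧ 0 < |ξ - a n| ∧
      |ξ - a n| < (expCube (algHeight (a n)))⁻¹ ^ (n + 1)

/-- A function `f : ℝ → ℝ` is transcendental if the only complex two-variable polynomial
`P` with `P (x, f x) = 0` for all real `x` is the zero polynomial. -/
def TranscendentalFun (f : ℝ → ℝ) : Prop :=
  ∀ P : MvPolynomial (Fin 2) ℂ,
    (∀ x : ℝ, MvPolynomial.eval ![(x : ℂ), (f x : ℂ)] P = 0) → P = 0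

open IsLocalization in
theorem exists_intMinpoly_map_eq (α : ℝ) (hα : IsAlgebraic ℚ α) :
    ∃ c : ℚ, c ≠ 0 ∧ (intMinpoly α).map (Int.castRingHom ℚ) = C c * minpoly ℚ α := by
  have h0 : minpoly ℚ α ≠ 0 := minpoly.ne_zero hα.isIntegral
  set N := integerNormalization (nonZeroDivisors ℤ) (minpoly ℚ α) with hN
  have hN0 : N ≠ 0 := by
    rw [hN, Ne, IsLocalization.integerNormalization_eq_zero_iff le_rfl]
    exact h0
  obtain ⟨b, hb, hbN⟩ := integerNormalization_spec (nonZeroDivisors ℤ) (minpoly ℚ α)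
  have hb0 : (b : ℚ) ≠ 0 := by exact_mod_cast nonZeroDivisors.ne_zero hb
  have hc0 : (N.content : ℚ) ≠ 0 := by
    exact_mod_cast mt content_eq_zero_iff.1 hN0
  refine ⟨(N.content : ℚ)⁻¹ * b, by positivity, ?_⟩
  have h1 : C (N.content : ℚ) * (intMinpoly α).map (Int.castRingHom ℚ)
      = C (b : ℚ) * minpoly ℚ α := by
    have h2 := congrArg (Polynomial.map (Int.castRingHom ℚ)) N.eq_C_content_mul_primPart
    rw [Polynomial.map_mul, map_C] at h2
    have h3 : N.map (Int.castRingHom ℚ) = b • minpoly ℚ α := hbN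
    rw [intMinpoly, ← hN]
    rw [h3, zsmul_eq_mul] at h2
    simpa using h2.symm
  rw [C_mul, mul_assoc, ← h1, ← mul_assoc, ← C_mul, inv_mul_cancel₀ hc0, C_1, one_mul]

theorem natDegree_intMinpoly (α : ℝ) (hα : IsAlgebraic ℚ α) :
    (intMinpoly α).natDegree = (minpoly ℚ α).natDegree := by
  obtain ⟨c, hc, h⟩ := exists_intMinpoly_map_eq α hα
  rw [← natDegree_map_eq_of_injective (Int.castRingHom ℚ).injective_int, h,
    natDegree_C_mul hc]

theorem intMinpoly_ne_zero (α : ℝ) : intMinpoly α ≠ 0 := primPart_ne_zero _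

theorem aeval_intMinpoly (α : ℝ) (hα : IsAlgebraic ℚ α) : aeval α (intMinpoly α) = 0 := by
  obtain ⟨c, -, h⟩ := exists_intMinpoly_map_eq α hα
  rw [← aeval_map_algebraMap ℚ, show algebraMap ℤ ℚ = Int.castRingHom ℚ from rfl, h]
  simp

theorem intMinpoly_dvd (α : ℝ) (hα : IsAlgebraic ℚ α) (Q : ℤ[X]) (hQ : aeval α Q = 0) :
    intMinpoly α ∣ Q := by
  obtain ⟨c, hc, h⟩ := exists_intMinpoly_map_eq α hα
  have hprim : (intMinpoly α).IsPrimitive := isPrimitive_primPart _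
  rw [IsPrimitive.Int.dvd_iff_map_cast_dvd_map_cast _ _ hprim, h]
  refine (isUnit_C.2 hc.isUnit).mul_left_dvd.2 (minpoly.dvd ℚ α ?_)
  rwa [show Int.castRingHom ℚ = algebraMap ℤ ℚ from rfl, aeval_map_algebraMap]

theorem natAbs_coeff_le_algHeight (α : ℝ) (i : ℕ) :
    ((intMinpoly α).coeff i).natAbs ≤ algHeight α := by
  by_cases hi : i ∈ (intMinpoly α).support
  · exact Finset.le_sup (f := fun i => ((intMinpoly α).coeff i).natAbs) hi
  · simp [notMem_support_iff.1 hi]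

theorem one_le_algHeight (α : ℝ) : 1 ≤ algHeight α :=
  (Int.natAbs_pos.2 (leadingCoeff_ne_zero.2 (intMinpoly_ne_zero α))).trans_le
    (natAbs_coeff_le_algHeight α _)

/-- The Mahler measure of an integer polynomial. -/
noncomputable def intMahler (P : ℤ[X]) : ℝ := (P.map (Int.castRingHom ℂ)).mahlerMeasure

theorem intMahler_intMinpoly_le (α : ℝ) :
    intMahler (intMinpoly α) ≤ ((intMinpoly α).natDegree + 1) * algHeight α := by
  refine (mahlerMeasure_le_sum_norm_coeff _).trans ?_
  rw [sum_over_range _ (by simp),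
    natDegree_map_eq_of_injective (Int.castRingHom ℂ).injective_int]
  refine (Finset.sum_le_card_nsmul _ _ (algHeight α : ℝ) fun i _ => ?_).trans (by simp)
  have := natAbs_coeff_le_algHeight α i
  rw [coeff_map, eq_intCast, Complex.norm_intCast, ← Int.cast_abs, Int.abs_eq_natAbs]
  exact_mod_cast this

theorem algHeight_le_of_root (β : ℝ) (Q : ℤ[X]) (hQ0 : Q ≠ 0) (hQ : aeval β Q = 0) :
    (algHeight β : ℝ) ≤ 2 ^ Q.natDegree * intMahler Q := by
  have hβ : IsAlgebraic ℚ β :=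
    IsAlgebraic.extendScalars (R := ℤ) (algebraMap ℤ ℚ).injective_int ⟨Q, hQ0, hQ⟩
  obtain ⟨R, hR⟩ := intMinpoly_dvd β hβ Q hQ
  have hR0 : R ≠ 0 := by rintro rfl; simp_all
  have hM : intMahler (intMinpoly β) ≤ intMahler Q := by
    rw [hR, intMahler, intMahler, Polynomial.map_mul, mahlerMeasure_mul]
    exact le_mul_of_one_le_right (mahlerMeasure_nonneg _) (one_le_mahlerMeasure_of_ne_zero hR0)
  have hdeg : (intMinpoly β).natDegree ≤ Q.natDegree := natDegree_le_of_dvd ⟨R, hR⟩ hQ0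
  obtain ⟨i, -, hi⟩ := Finset.exists_mem_eq_sup _ (support_nonempty.2 (intMinpoly_ne_zero β))
    fun i => ((intMinpoly β).coeff i).natAbs
  have h1 := norm_coeff_le_choose_mul_mahlerMeasure i ((intMinpoly β).map (Int.castRingHom ℂ))
  rw [natDegree_map_eq_of_injective (Int.castRingHom ℂ).injective_int, coeff_map, eq_intCast,
    Complex.norm_intCast, ← Int.cast_abs, Int.abs_eq_natAbs] at h1
  rw [algHeight, hi]
  refine (le_of_eq_of_le (by simp) h1).trans
    (mul_le_mul ?_ hM (mahlerMeasure_nonneg _) (by positivity))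
  have : (intMinpoly β).natDegree.choose i ≤ 2 ^ Q.natDegree :=
    (Nat.choose_le_two_pow _ _).trans (Nat.pow_le_pow_right two_pos hdeg)
  exact_mod_cast this

/-- The resultant in `Y` of `P(Y)` and `2(1 + Y²)X - Y`. It vanishes at `x / (2(1 + x²))`
for every root `x` of `P` with `1 + x² ≠ 0`. -/
noncomputable def transformPoly (P : ℤ[X]) : ℤ[X] :=
  resultant (P.map C) (C (2 * X) * X ^ 2 + C (-1) * X + C (2 * X)) P.natDegree 2

theorem transformPoly_map (P : ℤ[X]) :
    (transformPoly P).map (Int.castRingHom ℂ) =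
      C (P.leadingCoeff : ℂ) ^ 2 * ((P.map (Int.castRingHom ℂ)).roots.map
        fun r => C (2 * (1 + r ^ 2)) * X + C (-r)).prod := by
  have hP : (P.map (Int.castRingHom ℂ)).Splits := IsAlgClosed.splits _
  have hinj : Function.Injective (Int.castRingHom ℂ) := (Int.castRingHom ℂ).injective_int
  have h := resultant_eq_prod_eval ((P.map (Int.castRingHom ℂ)).map C)
    (C (2 * X) * X ^ 2 + C (-1) * X + C (2 * X)) 2 natDegree_quadratic_le (hP.map _)
  rw [natDegree_map_eq_of_injective C_injective, natDegree_map_eq_of_injective hinj,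
    leadingCoeff_map_of_injective C_injective, leadingCoeff_map_of_injective hinj,
    hP.roots_map, Multiset.map_map] at h
  rw [transformPoly, ← coe_mapRingHom, ← resultant_map_map]
  convert h using 2
  · rw [Polynomial.map_map, Polynomial.map_map]
    congr 1
    ext; simp
  · simp
  · simp
  · refine congrArg Multiset.prod (Multiset.map_congr rfl fun r _ => ?_)
    have h2 : (C 2 : ℂ[X]) = 2 := map_ofNat C 2
    simp [h2]
    ring

theorem mahlerMeasure_transform_factor_le (r : ℂ) :
    (C (2 * (1 + r ^ 2)) * X + C (-r)).mahlerMeasure ≤ 4 * max 1 ‖r‖ ^ 2 := by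
  have h1 : (1 : ℝ) ≤ max 1 ‖r‖ := le_max_left _ _
  have h2 : ‖r‖ ≤ max 1 ‖r‖ := le_max_right _ _
  have h3 : ‖r‖ ≤ 4 * max 1 ‖r‖ ^ 2 := by nlinarith
  by_cases h : 2 * (1 + r ^ 2) = 0
  · rw [h, C_0, zero_mul, zero_add, mahlerMeasure_const, norm_neg]
    exact h3
  · rw [mahlerMeasure_C_mul_X_add_C h, norm_neg]
    refine max_le ?_ h3
    have h4 : ‖1 + r ^ 2‖ ≤ 1 + ‖r‖ ^ 2 := by
      rw [← norm_pow, ← norm_one (α := ℂ)]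
      exact norm_add_le _ _
    rw [norm_mul, Complex.norm_ofNat]
    nlinarith [norm_nonneg r]

theorem intMahler_transformPoly_le (P : ℤ[X]) :
    intMahler (transformPoly P) ≤ 4 ^ P.natDegree * intMahler P ^ 2 := by
  have hinj : Function.Injective (Int.castRingHom ℂ) := (Int.castRingHom ℂ).injective_int
  have hP : (P.map (Int.castRingHom ℂ)).Splits := IsAlgClosed.splits _
  rw [intMahler, intMahler, transformPoly_map, mahlerMeasure_mul, ← C_pow, mahlerMeasure_const,
    prod_mahlerMeasure_eq_mahlerMeasure_prod, Multiset.map_map,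
    mahlerMeasure_eq_leadingCoeff_mul_prod_roots (P.map _), leadingCoeff_map_of_injective hinj,
    norm_pow, mul_pow, mul_left_comm, eq_intCast]
  refine mul_le_mul_of_nonneg_left ?_ (by positivity)
  refine (Multiset.prod_map_le_prod_map₀ _ (fun r => 4 * max 1 ‖r‖ ^ 2)
    (fun r _ => mahlerMeasure_nonneg _) fun r _ => mahlerMeasure_transform_factor_le r).trans_eq ?_
  rw [Multiset.prod_map_mul, Multiset.prod_map_pow, Multiset.map_const', Multiset.prod_replicate,
    ← hP.natDegree_eq_card_roots, natDegree_map_eq_of_injective hinj]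

theorem transformPoly_ne_zero (P : ℤ[X]) (hP : P ≠ 0) : transformPoly P ≠ 0 := by
  intro h
  have h1 := transformPoly_map P
  rw [h, Polynomial.map_zero, eq_comm, mul_eq_zero, Multiset.prod_eq_zero_iff] at h1
  rcases h1 with h1 | h1
  · simp [hP] at h1
  · obtain ⟨r, -, hr⟩ := Multiset.mem_map.1 h1
    have h0 := congrArg (coeff · 0) hr
    have h2 := congrArg (coeff · 1) hr
    simp at h0 h2
    simp [h0] at h2

theorem natDegree_transformPoly_le (P : ℤ[X]) : (transformPoly P).natDegree ≤ P.natDegree := by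
  have hinj : Function.Injective (Int.castRingHom ℂ) := (Int.castRingHom ℂ).injective_int
  have hP : (P.map (Int.castRingHom ℂ)).Splits := IsAlgClosed.splits _
  rw [← natDegree_map_eq_of_injective hinj, transformPoly_map, ← C_pow]
  refine (natDegree_C_mul_le _ _).trans ((natDegree_multiset_prod_le _).trans ?_)
  refine (Multiset.sum_le_card_nsmul _ 1 ?_).trans ?_
  · simp only [Multiset.mem_map]
    rintro _ ⟨_, ⟨r, -, rfl⟩, rfl⟩
    exact natDegree_linear_le
  · simp [← hP.natDegree_eq_card_roots, natDegree_map_eq_of_injective hinj]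

theorem aeval_transformPoly (P : ℤ[X]) (hP : P ≠ 0) (α : ℝ) (hα : aeval α P = 0) :
    aeval (α / (2 * (1 + α ^ 2))) (transformPoly P) = 0 := by
  apply Complex.ofReal_injective
  have hr : (α : ℂ) ∈ (P.map (Int.castRingHom ℂ)).roots := by
    rw [mem_roots_map_of_injective (Int.castRingHom ℂ).injective_int hP]
    have := aeval_algebraMap_apply ℂ α P
    rw [hα, map_zero] at this
    exact this
  have h1 := aeval_algebraMap_apply ℂ (α / (2 * (1 + α ^ 2))) (transformPoly P)
  have h2 : (1 + (α : ℂ) ^ 2) ≠ 0 := by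
    exact_mod_cast (by positivity : (1 + α ^ 2) ≠ 0)
  rw [Complex.coe_algebraMap] at h1
  rw [← h1, aeval_def, ← eval_map, show algebraMap ℤ ℂ = Int.castRingHom ℂ from rfl,
    transformPoly_map, eval_mul, eval_multiset_prod, Multiset.map_map]
  rw [Multiset.prod_eq_zero (Multiset.mem_map.2 ⟨_, hr, ?_⟩), mul_zero, Complex.ofReal_zero]
  simp
  field_simp
  ring

/-- If `α` is a real algebraic number of degree exactly `m` with `q = H(α)`, then
`β = α / (2(1 + α²))` is algebraic with `H(β) ≤ 2^(6m) q³`. -/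
theorem stmt_17 (m : ℕ) (hm : 1 ≤ m) (α : ℝ) (hα : DegreeExactly m α) :
    IsAlgebraic ℚ (α / (2 * (1 + α ^ 2))) ∧
      algHeight (α / (2 * (1 + α ^ 2))) ≤ 2 ^ (6 * m) * algHeight α ^ 3 := by
  have hP := intMinpoly_ne_zero α
  have hQ0 := transformPoly_ne_zero _ hP
  have hQ := aeval_transformPoly _ hP α (aeval_intMinpoly α hα.1)
  refine ⟨IsAlgebraic.extendScalars (R := ℤ) (algebraMap ℤ ℚ).injective_int ⟨_, hQ0, hQ⟩, ?_⟩
  have hdeg : (intMinpoly α).natDegree = m := (natDegree_intMinpoly α hα.1).trans hα.2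
  have hM := intMahler_intMinpoly_le α
  have hT := intMahler_transformPoly_le (intMinpoly α)
  have hD := natDegree_transformPoly_le (intMinpoly α)
  have hm2 : (m : ℝ) + 1 ≤ 2 ^ m := by exact_mod_cast Nat.lt_two_pow_self
  have hq : (1 : ℝ) ≤ algHeight α := by exact_mod_cast one_le_algHeight α
  rw [hdeg] at hM hT hD
  have hM0 : 0 ≤ intMahler (intMinpoly α) := mahlerMeasure_nonneg _
  have key : (algHeight (α / (2 * (1 + α ^ 2))) : ℝ) ≤ 2 ^ (6 * m) * (algHeight α : ℝ) ^ 3 :=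
    calc _ ≤ 2 ^ (transformPoly (intMinpoly α)).natDegree * intMahler (transformPoly _) :=
          algHeight_le_of_root _ _ hQ0 hQ
      _ ≤ 2 ^ m * (4 ^ m * (2 ^ m * algHeight α) ^ 2) := by
          refine mul_le_mul (pow_le_pow_right₀ one_le_two hD) (hT.trans ?_)
            (mahlerMeasure_nonneg _) (by positivity)
          gcongr
          exact hM.trans (by gcongr)
      _ = 2 ^ (5 * m) * (algHeight α : ℝ) ^ 2 := by
          rw [show (4 : ℝ) = 2 ^ 2 by norm_num, ← pow_mul]
          ring
      _ ≤ _ := by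
          gcongr <;> first | exact one_le_two | exact hq | omega
  exact_mod_cast key
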